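/- arXiv:2601.05636 — 8 statements merged into one kernel-verified Lean document; each statement's English description precedes it below -/
import Mathlib

section
/- Projection bound: let q ≥ 1 and 0 ≤ t ≤ n. Let C be a finite set of multisets over Fin q, each of cardinality n, such that every two distinct S, T ∈ C satisfy card(S ∩ T) ≤ n − t − 1 (i.e., C corrects t deletions). Then |C| ≤ binom(n − t + q − 1, q − 1), the number of cardinality-(n−t) multisets over Fin q. -/
theorem Multiset.exists_le_card_eq_of_le_card {α : Type*} {s : Multiset α} {k : ℕ}
    (h : k ≤ Multiset.card s) : ∃ u ≤ s, Multiset.card u = k := by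
  have hpos : 0 < Multiset.card (Multiset.powersetCard k s) := by
    rw [Multiset.card_powersetCard]
    exact Nat.choose_pos h
  obtain ⟨u, hu⟩ := Multiset.card_pos_iff_exists_mem.mp hpos
  exact ⟨u, Multiset.mem_powersetCard.mp hu⟩

/-- Projection bound: a code of cardinality-`n` multisets over `Fin q`
correcting `t` deletions has size at most `C(n - t + q - 1, q - 1)`. -/
theorem multiset_projection_bound (q n t : ℕ) (hq : 1 ≤ q) (ht : t ≤ n)
    (C : Finset (Multiset (Fin q)))
    (hcard : ∀ S ∈ C, Multiset.card S = n)
    (hdel : ∀ S ∈ C, ∀ T ∈ C, S ≠ T →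
      (Multiset.card (S ∩ T) : ℤ) ≤ (n : ℤ) - t - 1) :
    C.card ≤ Nat.choose (n - t + q - 1) (q - 1) := by
  have hsub : ∀ S : C, ∃ u ≤ S.1, Multiset.card u = n - t := fun S =>
    Multiset.exists_le_card_eq_of_le_card (by rw [hcard S.1 S.2]; exact Nat.sub_le n t)
  choose f hf_le hf_card using hsub
  have hinj : Function.Injective fun S : C => (⟨f S, hf_card S⟩ : Sym (Fin q) (n - t)) := by
    intro S T hST
    have hfST : f S = f T := congrArg Subtype.val hST
    by_contra hne
    have hle : f S ≤ S.1 ∩ T.1 := Multiset.le_inter (hf_le S) (hfST ▸ hf_le T)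
    have hcard_le := Multiset.card_le_card hle
    rw [hf_card] at hcard_le
    have hinter := hdel S.1 S.2 T.1 T.2 fun h => hne (Subtype.ext h)
    omega
  have hle := Fintype.card_le_of_injective (β := Sym (Fin q) (n - t)) _ hinj
  rw [Fintype.card_coe, Sym.card_sym_eq_choose, Fintype.card_fin] at hle
  rwa [show q + (n - t) - 1 = n - t + q - 1 by omega,
    Nat.choose_symm_of_eq_add (show n - t + q - 1 = n - t + (q - 1) by omega)] at hle
end

section
/- The cases q = 2 and q = 3 for t = n − 2: let q ∈ {2, 3} and n ≥ 4. Let C be a finite set of multisets over Fin q, each of cardinality n, such that every two distinct S, T ∈ C satisfy card(S ∩ T) ≤ 1 (i.e., C corrects n − 2 deletions). Then |C| ≤ q. -/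
/-- A multiset with more elements than its alphabet has a repeated symbol. -/
theorem Multiset.exists_two_le_count_of_card_lt {α : Type*} [Fintype α] [DecidableEq α]
    {S : Multiset α} (h : Fintype.card α < Multiset.card S) : ∃ x, 2 ≤ S.count x := by
  by_contra! hS
  have hnodup : S.Nodup := Multiset.nodup_iff_count_le_one.2 fun x => Nat.le_of_lt_succ (hS x)
  exact (Finset.card_le_univ ⟨S, hnodup⟩).not_gt h

/-- Multisets larger than their alphabet that pairwise share at most one element
are at most as many as the symbols. -/
theorem Multiset.card_code_le_card_alphabet {α : Type*} [Fintype α] [DecidableEq α]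
    (C : Finset (Multiset α)) (hcard : ∀ S ∈ C, Fintype.card α < Multiset.card S)
    (hint : ∀ S ∈ C, ∀ T ∈ C, S ≠ T → Multiset.card (S ∩ T) ≤ 1) :
    C.card ≤ Fintype.card α := by
  choose f hf using fun S : C => Multiset.exists_two_le_count_of_card_lt (hcard S S.2)
  rw [← Fintype.card_coe]
  refine Fintype.card_le_of_injective f fun S T hST => ?_
  by_contra hne
  have hT := hf T
  rw [← hST] at hT
  have hcount : 2 ≤ (S.1 ∩ T.1).count (f S) := by
    rw [Multiset.count_inter]
    exact le_min (hf S) hT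
  have := Multiset.count_le_card (f S) (S.1 ∩ T.1)
  have := hint S S.2 T T.2 (Subtype.coe_ne_coe.2 hne)
  omega

/-- The cases `q = 2` and `q = 3` for `t = n - 2`: a code of cardinality-`n`
multisets (`n ≥ 4`) whose distinct codewords intersect in at most one element
has size at most `q`. -/
theorem multiset_code_t_eq_n_sub_two_small_q (q n : ℕ)
    (hq : q = 2 ∨ q = 3) (hn : 4 ≤ n)
    (C : Finset (Multiset (Fin q)))
    (hcard : ∀ S ∈ C, Multiset.card S = n)
    (hint : ∀ S ∈ C, ∀ T ∈ C, S ≠ T → Multiset.card (S ∩ T) ≤ 1) :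
    C.card ≤ q := by
  have hlt : ∀ S ∈ C, Fintype.card (Fin q) < Multiset.card S := by
    intro S hS
    rw [hcard S hS, Fintype.card_fin]
    omega
  simpa using Multiset.card_code_le_card_alphabet C hlt hint
end

section
/- Upper bound for t = n − 3: let q ≥ 2 and n ≥ q + 2. Let C be a finite set of multisets over Fin q, each of cardinality n, such that every two distinct S, T ∈ C satisfy card(S ∩ T) ≤ 2 (i.e., C corrects n − 3 deletions). Then |C| · ((n − 1) − q) ≤ q² · (n − 2); equivalently |C| ≤ q²(n−2)/((n−1)−q). -/
/-- A multiset with more elements than its ambient alphabet repeats a symbol. -/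
theorem Multiset.exists_pair_le_of_card_lt {α : Type*} [Fintype α] (S : Multiset α)
    (hS : Fintype.card α < Multiset.card S) : ∃ y, ({y, y} : Multiset α) ≤ S := by
  classical
  by_contra! h
  have hnodup : S.Nodup := Multiset.nodup_iff_le.2 h
  have hle : (⟨S, hnodup⟩ : Finset α).card ≤ Fintype.card α := Finset.card_le_univ _
  exact absurd hS (not_lt.2 hle)

/-- A multiset with at least two more elements than its ambient alphabet contains a
triple `{x, y, y}`. -/
theorem Multiset.exists_triple_le_of_card_lt {α : Type*} [Fintype α] (S : Multiset α)
    (hS : Fintype.card α + 2 ≤ Multiset.card S) :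
    ∃ p : α × α, ({p.1, p.2, p.2} : Multiset α) ≤ S := by
  have hpos : 0 < Multiset.card S := by omega
  obtain ⟨x, hx⟩ := Multiset.card_pos_iff_exists_mem.1 hpos
  obtain ⟨R, rfl⟩ := Multiset.exists_cons_of_mem hx
  rw [Multiset.card_cons] at hS
  obtain ⟨y, hy⟩ := R.exists_pair_le_of_card_lt (by omega)
  exact ⟨(x, y), (Multiset.cons_le_cons_iff x).2 hy⟩

/-- Upper bound for `t = n - 3`: if `q ≥ 2`, `n ≥ q + 2`, and every two
distinct codewords intersect in at most two elements, then
`|C| ((n-1) - q) ≤ q² (n - 2)`. -/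
theorem multiset_bound_t_eq_n_sub_three (q n : ℕ) (hq : 2 ≤ q) (hn : q + 2 ≤ n)
    (C : Finset (Multiset (Fin q)))
    (hcard : ∀ S ∈ C, Multiset.card S = n)
    (hint : ∀ S ∈ C, ∀ T ∈ C, S ≠ T → Multiset.card (S ∩ T) ≤ 2) :
    C.card * ((n - 1) - q) ≤ q ^ 2 * (n - 2) := by
  have htriple : ∀ S : Multiset (Fin q), ∃ p : Fin q × Fin q,
      S ∈ C → ({p.1, p.2, p.2} : Multiset (Fin q)) ≤ S := by
    intro S
    by_cases hS : S ∈ C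
    · obtain ⟨p, hp⟩ := S.exists_triple_le_of_card_lt
        (by rw [Fintype.card_fin, hcard S hS]; exact hn)
      exact ⟨p, fun _ => hp⟩
    · exact ⟨(⟨0, by omega⟩, ⟨0, by omega⟩), fun h => absurd h hS⟩
  choose f hf using htriple
  have hinj : Set.InjOn f C := by
    intro S hS T hT hST
    by_contra hne
    have hle := Multiset.card_le_card
      (Multiset.le_inter (hf S hS) (hST ▸ hf T hT))
    have htwo := hint S hS T hT hne
    simp only [Multiset.insert_eq_cons, Multiset.card_cons, Multiset.card_singleton] at hle
    omega
  have hC : C.card ≤ q ^ 2 := by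
    have h := Finset.card_le_card_of_injOn f (fun _ _ => Finset.mem_univ _) hinj
    simpa [sq] using h
  exact Nat.mul_le_mul hC (by omega)
end

section
/- Recursive puncturing upper bound: let q ≥ 1 and 1 ≤ k ≤ n. Let C be a finite set of multisets over Fin q, each of cardinality n, such that every two distinct S, T ∈ C satisfy card(S ∩ T) ≤ k − 1 (i.e., C corrects n − k deletions). Then |C| ≤ q^k. Equivalently, S_q(n, t) ≤ q^{n−t} for every 0 ≤ t ≤ n − 1. -/
/-- Recursive puncturing upper bound: a code of cardinality-`n` multisets over
`Fin q` in which every two distinct codewords intersect in at most `k - 1`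
elements (i.e., correcting `n - k` deletions) has size at most `q ^ k`. -/
theorem multiset_recursive_puncturing_bound (q n k : ℕ)
    (hq : 1 ≤ q) (hk : 1 ≤ k) (hkn : k ≤ n)
    (C : Finset (Multiset (Fin q)))
    (hcard : ∀ S ∈ C, Multiset.card S = n)
    (hint : ∀ S ∈ C, ∀ T ∈ C, S ≠ T → Multiset.card (S ∩ T) ≤ k - 1) :
    C.card ≤ q ^ k := by
  have hlen (S : C) : (S.1.toList.take k).length = k := by
    simp [hcard S.1 S.2, hkn]
  let f : C → List.Vector (Fin q) k := fun S => ⟨S.1.toList.take k, hlen S⟩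
  have hf : Function.Injective f := by
    intro S T h
    by_contra hST
    have htake : S.1.toList.take k = T.1.toList.take k := congrArg Subtype.val h
    have hle (U : C) : (U.1.toList.take k : Multiset (Fin q)) ≤ U.1 := by
      conv_rhs => rw [← Multiset.coe_toList U.1]
      exact Multiset.coe_le.2 (List.take_sublist _ _).subperm
    have hinter := Multiset.card_le_card (Multiset.le_inter (hle S) (htake ▸ hle T))
    rw [Multiset.coe_card, hlen] at hinter
    have := hint S.1 S.2 T.1 T.2 (fun e => hST (Subtype.ext e))
    omega
  simpa using Fintype.card_le_of_injective f hf
end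

section
/- Correctness of the binary congruence construction: let n ≥ 1 and t ≥ 1, and let S and T be multisets over Fin 2, each of cardinality n, whose weights are congruent modulo t + 1, i.e., count(1, S) ≡ count(1, T) (mod t + 1). If card(S ∩ T) ≥ n − t, then S = T. Consequently, for every residue a, the code C₂(a) = { S : card S = n, count(1, S) ≡ a (mod t+1) } corrects t deletions. -/
theorem card_eq_count_zero_add_count_one (S : Multiset (Fin 2)) :
    Multiset.card S = S.count 0 + S.count 1 := by
  rw [← Multiset.sum_count_eq_card (s := Finset.univ) (fun a _ => Finset.mem_univ a),
    Fin.sum_univ_two]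

/-- Distinct binary multisets of equal cardinality with weights congruent mod `m` have an
intersection smaller by at least `m`. -/
theorem card_inter_add_le_of_modEq {m : ℕ} {S T : Multiset (Fin 2)}
    (hcard : Multiset.card S = Multiset.card T)
    (hmod : S.count 1 ≡ T.count 1 [MOD m]) (hne : S ≠ T) :
    Multiset.card (S ∩ T) + m ≤ Multiset.card S := by
  have hS := card_eq_count_zero_add_count_one S
  have hT := card_eq_count_zero_add_count_one T
  have hI := card_eq_count_zero_add_count_one (S ∩ T)
  simp only [Multiset.count_inter] at hI
  rcases lt_trichotomy (S.count 1) (T.count 1) with h | h | h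
  · have := hmod.add_le_of_lt h
    omega
  · refine absurd (Multiset.ext.2 fun a => ?_) hne
    fin_cases a
    · change S.count 0 = T.count 0
      omega
    · exact h
  · have := hmod.symm.add_le_of_lt h
    omega

/-- Correctness of the binary congruence construction: two cardinality-`n`
binary multisets whose weights are congruent mod `t+1` and which share at
least `n - t` elements must be equal; consequently each congruence class
`C₂(a)` corrects `t` deletions. -/
theorem binary_congruence_code_corrects (n t : ℕ) (hn : 1 ≤ n) (ht : 1 ≤ t) :
    (∀ S T : Multiset (Fin 2), Multiset.card S = n → Multiset.card T = n →
      S.count 1 % (t + 1) = T.count 1 % (t + 1) →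
      n - t ≤ Multiset.card (S ∩ T) → S = T)
    ∧ (∀ a : ℕ, ∀ S T : Multiset (Fin 2),
        Multiset.card S = n → Multiset.card T = n →
        S.count 1 % (t + 1) = a % (t + 1) →
        T.count 1 % (t + 1) = a % (t + 1) →
        S ≠ T → (Multiset.card (S ∩ T) : ℤ) ≤ (n : ℤ) - t - 1) := by
  constructor
  · intro S T hS hT hmod hle
    by_contra hne
    have := card_inter_add_le_of_modEq (hS.trans hT.symm) hmod hne
    omega
  · intro a S T hS hT hSa hTa hne
    have := card_inter_add_le_of_modEq (hS.trans hT.symm) (hSa.trans hTa.symm) hne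
    omega
end

section
/- Correctness of the sum-modulo-q single-deletion construction: let q ≥ 1 and n ≥ 1, and let S and T be multisets over Fin q, each of cardinality n, such that the symbol sums are congruent modulo q: Σ_{s ∈ S} s ≡ Σ_{s ∈ T} s (mod q), where each symbol s ∈ Fin q is identified with its integer value in {0, …, q−1}. If card(S ∩ T) ≥ n − 1, then S = T. Consequently, for each a the code C₁(a) = { S : card S = n, Σ_{s ∈ S} s ≡ a (mod q) } corrects one deletion. -/
/-- Two multisets over `Fin q` of the same cardinality whose symbol sums agree modulo `q` are equal
as soon as their intersection misses at most one element of each. -/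
theorem Multiset.eq_of_sum_val_modEq_of_card_le_card_inter_add_one {q : ℕ} {S T : Multiset (Fin q)}
    (hcard : card S = card T)
    (hsum : (S.map Fin.val).sum ≡ (T.map Fin.val).sum [MOD q])
    (hinter : card S ≤ card (S ∩ T) + 1) : S = T := by
  obtain ⟨A, hA⟩ := Multiset.le_iff_exists_add.mp (Multiset.inter_le_left (s := S) (t := T))
  obtain ⟨B, hB⟩ := Multiset.le_iff_exists_add.mp (Multiset.inter_le_right (s := S) (t := T))
  generalize S ∩ T = U at hA hB hinter
  subst hA hB
  simp only [Multiset.card_add] at hcard hinter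
  rcases Nat.le_one_iff_eq_zero_or_eq_one.mp (show card A ≤ 1 by omega) with h | h
  · rw [Multiset.card_eq_zero.mp h, Multiset.card_eq_zero.mp (show card B = 0 by omega)]
  · obtain ⟨x, rfl⟩ := Multiset.card_eq_one.mp h
    obtain ⟨y, rfl⟩ := Multiset.card_eq_one.mp (show card B = 1 by omega)
    simp only [Multiset.map_add, Multiset.sum_add, Multiset.map_singleton,
      Multiset.sum_singleton] at hsum
    rw [Fin.ext (Nat.ModEq.eq_of_lt_of_lt (Nat.ModEq.add_left_cancel' _ hsum) x.isLt y.isLt)]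

/-- Correctness of the sum-modulo-`q` single-deletion construction: two
cardinality-`n` multisets over `Fin q` with congruent symbol sums mod `q`
sharing at least `n - 1` elements are equal; consequently each class `C₁(a)`
corrects one deletion. -/
theorem sum_mod_q_single_deletion_correct (q n : ℕ) (hq : 1 ≤ q) (hn : 1 ≤ n) :
    (∀ S T : Multiset (Fin q), Multiset.card S = n → Multiset.card T = n →
      (S.map Fin.val).sum % q = (T.map Fin.val).sum % q →
      n - 1 ≤ Multiset.card (S ∩ T) → S = T)
    ∧ (∀ a : ℕ, ∀ S T : Multiset (Fin q),
        Multiset.card S = n → Multiset.card T = n →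
        (S.map Fin.val).sum % q = a % q →
        (T.map Fin.val).sum % q = a % q →
        S ≠ T → (Multiset.card (S ∩ T) : ℤ) ≤ (n : ℤ) - 2) := by
  refine ⟨fun S T hS hT hsum hinter =>
    Multiset.eq_of_sum_val_modEq_of_card_le_card_inter_add_one (hS.trans hT.symm) hsum (by omega),
    fun a S T hS hT hSa hTa hne => ?_⟩
  by_contra! hlt
  exact hne (Multiset.eq_of_sum_val_modEq_of_card_le_card_inter_add_one (hS.trans hT.symm)
    (hSa.trans hTa.symm) (by omega))
end

section
/- Injectivity of the Sidon-type syndrome: let q ≥ 2 and t ≥ 1. Define f : Fin q → ℕ by f(i) = (t+1)^i for 0 ≤ i ≤ q − 2 and f(q−1) = 0, and set m = t·(t+1)^{q−2} + 1. If E₁ and E₂ are multisets over Fin q, each of cardinality t, such that Σ_{s ∈ E₁} f(s) ≡ Σ_{s ∈ E₂} f(s) (mod m), then E₁ = E₂. -/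
/-- Base-`b` expansions with `n` digits are unique. -/
theorem digit_sum_injective {n b : ℕ} {x y : Fin n → ℕ} (hx : ∀ i, x i < b) (hy : ∀ i, y i < b)
    (h : ∑ i, x i * b ^ (i : ℕ) = ∑ i, y i * b ^ (i : ℕ)) : x = y := by
  have key : (fun i => (⟨x i, hx i⟩ : Fin b)) = fun i => ⟨y i, hy i⟩ := by
    apply finFunctionFinEquiv.injective
    apply Fin.ext
    simpa only [finFunctionFinEquiv_apply] using h
  funext i
  exact congrArg Fin.val (congrFun key i)

/-- Two multisets over `Fin (n + 1)` of equal cardinality agree as soon as they have the same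
multiplicities away from the last element. -/
theorem Multiset.eq_of_card_eq_of_count_castSucc {n : ℕ} {E F : Multiset (Fin (n + 1))}
    (hcard : E.card = F.card) (h : ∀ i : Fin n, E.count i.castSucc = F.count i.castSucc) :
    E = F := by
  have hE := Multiset.sum_count_eq_card (s := Finset.univ) (m := E) (by simp)
  have hF := Multiset.sum_count_eq_card (s := Finset.univ) (m := F) (by simp)
  rw [Fin.sum_univ_castSucc] at hE hF
  simp only [h] at hE
  ext a
  induction a using Fin.lastCases with
  | last => lia
  | cast i => exact h i

/-- Injectivity of the Sidon-type syndrome: with `f(i) = (t+1)^i` for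
`i ≤ q - 2`, `f(q-1) = 0`, and `m = t(t+1)^{q-2} + 1`, any two cardinality-`t`
multisets over `Fin q` with congruent `f`-sums mod `m` are equal. -/
theorem sidon_syndrome_injective (q t : ℕ) (hq : 2 ≤ q) (ht : 1 ≤ t)
    (f : Fin q → ℕ)
    (hf : ∀ i : Fin q, f i = if (i : ℕ) = q - 1 then 0 else (t + 1) ^ (i : ℕ))
    (E₁ E₂ : Multiset (Fin q))
    (h₁ : Multiset.card E₁ = t) (h₂ : Multiset.card E₂ = t)
    (hsum : (E₁.map f).sum % (t * (t + 1) ^ (q - 2) + 1)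
          = (E₂.map f).sum % (t * (t + 1) ^ (q - 2) + 1)) :
    E₁ = E₂ := by
  obtain ⟨n, rfl⟩ : ∃ n, q = n + 2 := ⟨q - 2, by lia⟩
  simp only [Nat.add_sub_cancel, show n + 2 - 1 = n + 1 by lia] at hf hsum
  have f_le (i : Fin (n + 2)) : f i ≤ (t + 1) ^ n := by
    rw [hf]
    split_ifs
    · exact Nat.zero_le _
    · exact Nat.pow_le_pow_right (by lia) (by lia)
  have sum_lt (E : Multiset (Fin (n + 2))) (hE : E.card = t) :
      (E.map f).sum < t * (t + 1) ^ n + 1 := by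
    have := Multiset.sum_le_card_nsmul (E.map f) ((t + 1) ^ n) (by simpa using fun i _ => f_le i)
    simpa [hE, Nat.lt_succ_iff] using this
  have sum_eq (E : Multiset (Fin (n + 2))) :
      (E.map f).sum = ∑ i : Fin (n + 1), E.count i.castSucc * (t + 1) ^ (i : ℕ) := by
    rw [Finset.sum_multiset_map_count,
      Finset.sum_subset (Finset.subset_univ _) (by simp +contextual), Fin.sum_univ_castSucc]
    simp [hf, Fin.is_lt _ |>.ne]
  rw [Nat.mod_eq_of_lt (sum_lt E₁ h₁), Nat.mod_eq_of_lt (sum_lt E₂ h₂), sum_eq, sum_eq] at hsum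
  have count_lt (E : Multiset (Fin (n + 2))) (hE : E.card = t) (i : Fin (n + 1)) :
      E.count i.castSucc < t + 1 :=
    Nat.lt_succ_of_le (hE ▸ Multiset.count_le_card _ E)
  exact Multiset.eq_of_card_eq_of_count_castSucc (h₁.trans h₂.symm)
    (congrFun (digit_sum_injective (count_lt E₁ h₁) (count_lt E₂ h₂) hsum))
end

section
/- Correctness of the cyclic Sidon-type construction: let q ≥ 2, t ≥ 1, and n ≥ t. Define f : Fin q → ℕ by f(i) = (t+1)^i for 0 ≤ i ≤ q − 2 and f(q−1) = 0, and set m = t·(t+1)^{q−2} + 1. Let S and T be multisets over Fin q, each of cardinality n, with Σ_{s ∈ S} f(s) ≡ Σ_{s ∈ T} f(s) (mod m). If card(S ∩ T) ≥ n − t, then S = T. Consequently, for each residue a ∈ ℤ_m the code C_q(a) = { S : card S = n, Σ_{s ∈ S} f(s) ≡ a (mod m) } corrects t deletions. -/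
/-- Base-`b` expansions of fixed length with digits below `b` are unique. -/
theorem eq_of_sum_mul_pow_eq {k b : ℕ} {u v : Fin k → ℕ} (hu : ∀ i, u i < b) (hv : ∀ i, v i < b)
    (h : ∑ i, u i * b ^ (i : ℕ) = ∑ i, v i * b ^ (i : ℕ)) : u = v := by
  have key : (fun i => (⟨u i, hu i⟩ : Fin b)) = fun i => ⟨v i, hv i⟩ := by
    apply finFunctionFinEquiv.injective
    apply Fin.ext
    simpa only [finFunctionFinEquiv_apply] using h
  funext i
  simpa using congrFun key i

theorem Multiset.sum_map_eq_sum_univ_count {α : Type*} [Fintype α] [DecidableEq α]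
    (S : Multiset α) (f : α → ℕ) : (S.map f).sum = ∑ i, S.count i * f i := by
  rw [Finset.sum_multiset_map_count]
  exact Finset.sum_subset (Finset.subset_univ _) fun i _ hi => by simp_all

/-- A multiset over `Fin (k + 1)` with at most `t` elements is determined by its cardinality and
its sum of weights `(t + 1) ^ i` over the symbols other than the last one. -/
theorem Multiset.eq_of_card_eq_of_sum_pow_eq {k t : ℕ} {f : Fin (k + 1) → ℕ}
    (hf : ∀ i : Fin k, f i.castSucc = (t + 1) ^ (i : ℕ)) (hlast : f (Fin.last k) = 0)
    {U V : Multiset (Fin (k + 1))} (hU : card U ≤ t) (hUV : card U = card V)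
    (h : (U.map f).sum = (V.map f).sum) : U = V := by
  have hdigits : (fun i : Fin k => U.count i.castSucc) = fun i : Fin k => V.count i.castSucc := by
    apply eq_of_sum_mul_pow_eq (b := t + 1)
    · exact fun i => Nat.lt_succ_of_le ((Multiset.count_le_card _ _).trans hU)
    · exact fun i => Nat.lt_succ_of_le ((Multiset.count_le_card _ _).trans (hUV ▸ hU))
    · simpa [sum_map_eq_sum_univ_count, Fin.sum_univ_castSucc, hf, hlast] using h
  have hcount (i : Fin k) : U.count i.castSucc = V.count i.castSucc := congrFun hdigits i
  have hcard : ∑ i, U.count i = ∑ i, V.count i := by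
    simpa [Multiset.sum_count_eq_card] using hUV
  simp only [Fin.sum_univ_castSucc, hcount, Nat.add_left_cancel_iff] at hcard
  ext i
  induction i using Fin.lastCases with
  | last => exact hcard
  | cast i => exact hcount i

/-- Two multisets of equal cardinality with congruent weight sums that differ in at most `t`
elements are equal. -/
theorem Multiset.eq_of_sum_pow_modEq {k t : ℕ} {f : Fin (k + 2) → ℕ}
    (hf : ∀ i : Fin (k + 1), f i.castSucc = (t + 1) ^ (i : ℕ)) (hlast : f (Fin.last (k + 1)) = 0)
    {S T : Multiset (Fin (k + 2))} (hST : card S = card T)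
    (h : (S.map f).sum ≡ (T.map f).sum [MOD t * (t + 1) ^ k + 1])
    (hinter : card S ≤ card (S ∩ T) + t) : S = T := by
  obtain ⟨U, hU⟩ := Multiset.le_iff_exists_add.1 (Multiset.inter_le_left : S ∩ T ≤ S)
  obtain ⟨V, hV⟩ := Multiset.le_iff_exists_add.1 (Multiset.inter_le_right : S ∩ T ≤ T)
  have hcardS := congrArg card hU
  have hcardT := congrArg card hV
  rw [card_add] at hcardS hcardT
  have hbound (i : Fin (k + 2)) : f i ≤ (t + 1) ^ k := by
    induction i using Fin.lastCases with
    | last => simp [hlast]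
    | cast i => rw [hf]; exact Nat.pow_le_pow_right (by omega) (by omega)
  have hsum (W : Multiset (Fin (k + 2))) (hW : card W ≤ t) :
      (W.map f).sum < t * (t + 1) ^ k + 1 := by
    have := Multiset.sum_le_card_nsmul (W.map f) ((t + 1) ^ k) (by simpa using fun i _ => hbound i)
    rw [card_map, smul_eq_mul] at this
    exact Nat.lt_succ_of_le (this.trans (Nat.mul_le_mul_right _ hW))
  have hmapS := congrArg (fun W => (W.map f).sum) hU
  have hmapT := congrArg (fun W => (W.map f).sum) hV
  simp only [Multiset.map_add, Multiset.sum_add] at hmapS hmapT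
  rw [hmapS, hmapT] at h
  have hUV : U = V := eq_of_card_eq_of_sum_pow_eq hf hlast (by omega) (by omega)
    ((Nat.ModEq.add_left_cancel' _ h).eq_of_lt_of_lt (hsum U (by omega)) (hsum V (by omega)))
  exact hU.trans ((congrArg (S ∩ T + ·) hUV).trans hV.symm)

/-- Correctness of the cyclic Sidon-type construction: with
`f(i) = (t+1)^i` for `i ≤ q - 2`, `f(q-1) = 0`, and `m = t(t+1)^{q-2} + 1`,
two cardinality-`n` multisets with congruent `f`-sums mod `m` sharing at
least `n - t` elements are equal; consequently each class `C_q(a)` corrects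
`t` deletions. -/
theorem cyclic_sidon_construction_correct (q t n : ℕ)
    (hq : 2 ≤ q) (ht : 1 ≤ t) (hn : t ≤ n)
    (f : Fin q → ℕ)
    (hf : ∀ i : Fin q, f i = if (i : ℕ) = q - 1 then 0 else (t + 1) ^ (i : ℕ)) :
    (∀ S T : Multiset (Fin q), Multiset.card S = n → Multiset.card T = n →
      (S.map f).sum % (t * (t + 1) ^ (q - 2) + 1)
        = (T.map f).sum % (t * (t + 1) ^ (q - 2) + 1) →
      n - t ≤ Multiset.card (S ∩ T) → S = T)
    ∧ (∀ a : ℕ, ∀ S T : Multiset (Fin q),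
        Multiset.card S = n → Multiset.card T = n →
        (S.map f).sum % (t * (t + 1) ^ (q - 2) + 1)
          = a % (t * (t + 1) ^ (q - 2) + 1) →
        (T.map f).sum % (t * (t + 1) ^ (q - 2) + 1)
          = a % (t * (t + 1) ^ (q - 2) + 1) →
        S ≠ T → (Multiset.card (S ∩ T) : ℤ) ≤ (n : ℤ) - t - 1) := by
  obtain ⟨k, rfl⟩ := Nat.exists_eq_add_of_le' hq
  have hcast (i : Fin (k + 1)) : f i.castSucc = (t + 1) ^ (i : ℕ) := by
    rw [hf, if_neg (by simp; omega), Fin.val_castSucc]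
  have hlast : f (Fin.last (k + 1)) = 0 := by simp [hf]
  have main (S T : Multiset (Fin (k + 2))) (hS : Multiset.card S = n) (hT : Multiset.card T = n)
      (h : (S.map f).sum % (t * (t + 1) ^ k + 1) = (T.map f).sum % (t * (t + 1) ^ k + 1))
      (hinter : n - t ≤ Multiset.card (S ∩ T)) : S = T :=
    Multiset.eq_of_sum_pow_modEq hcast hlast (hS.trans hT.symm) h (by omega)
  refine ⟨main, fun a S T hS hT hSa hTa hne => ?_⟩
  by_contra hlt
  exact hne (main S T hS hT (hSa.trans hTa.symm) (by omega))
end
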